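/- Suppose ε_2 ∉ K. Let n ≥ 1, a ∈ K*, A = K[X]/(X^{2^n} − a), and suppose H_n(a) = 0. Then A has a unique minimal idempotent, namely the unity element 1 of A. -/

import Mathlib

noncomputable section

/-- `x ∈ K̄` lies in (the image of) the base field `K`. -/
def InK (K : Type*) [Field K] (x : AlgebraicClosure K) : Prop :=
  x ∈ Set.range (algebraMap K (AlgebraicClosure K))

/-- Type A: `ε₂ ∈ K` and `εₙ ∈ K` for every `n`. -/
def TypeA (K : Type*) [Field K] (ε : ℕ → AlgebraicClosure K) : Prop :=
  InK K (ε 2) ∧ ∀ n : ℕ, InK K (ε n)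

/-- Type B: `ε₂ ∈ K` and there is a unique `m ≥ 2` with `ε_m ∈ K`, `ε_{m+1} ∉ K`. -/
def TypeB (K : Type*) [Field K] (ε : ℕ → AlgebraicClosure K) : Prop :=
  InK K (ε 2) ∧ ∃! m : ℕ, 2 ≤ m ∧ InK K (ε m) ∧ ¬InK K (ε (m + 1))

/-- Type C: `ε₂ ∉ K` and `εₙ + εₙ⁻¹ ∈ K` for every `n`. -/
def TypeC (K : Type*) [Field K] (ε : ℕ → AlgebraicClosure K) : Prop :=
  ¬InK K (ε 2) ∧ ∀ n : ℕ, InK K (ε n + (ε n)⁻¹)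

/-- Type D: `ε₂ ∉ K` and there is a unique `m ≥ 2` with `ε_m + ε_m⁻¹ ∈ K`,
`ε_{m+1} + ε_{m+1}⁻¹ ∉ K` and `ε_{m+1} - ε_{m+1}⁻¹ ∉ K`. -/
def TypeD (K : Type*) [Field K] (ε : ℕ → AlgebraicClosure K) : Prop :=
  ¬InK K (ε 2) ∧ ∃! m : ℕ, 2 ≤ m ∧ InK K (ε m + (ε m)⁻¹) ∧
    ¬InK K (ε (m + 1) + (ε (m + 1))⁻¹) ∧ ¬InK K (ε (m + 1) - (ε (m + 1))⁻¹)

/-- Type E: `ε₂ ∉ K` and there is a unique `m ≥ 3` with `ε_m - ε_m⁻¹ ∈ K`. -/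
def TypeE (K : Type*) [Field K] (ε : ℕ → AlgebraicClosure K) : Prop :=
  ¬InK K (ε 2) ∧ ∃! m : ℕ, 3 ≤ m ∧ InK K (ε m - (ε m)⁻¹)

/-- Type B with constant `m`. -/
def TypeBc (K : Type*) [Field K] (ε : ℕ → AlgebraicClosure K) (m : ℕ) : Prop :=
  InK K (ε 2) ∧ 2 ≤ m ∧ InK K (ε m) ∧ ¬InK K (ε (m + 1))

/-- Type D with constant `m`. -/
def TypeDc (K : Type*) [Field K] (ε : ℕ → AlgebraicClosure K) (m : ℕ) : Prop :=
  ¬InK K (ε 2) ∧ 2 ≤ m ∧ InK K (ε m + (ε m)⁻¹) ∧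
    ¬InK K (ε (m + 1) + (ε (m + 1))⁻¹) ∧ ¬InK K (ε (m + 1) - (ε (m + 1))⁻¹)

/-- Type E with constant `m`. -/
def TypeEc (K : Type*) [Field K] (ε : ℕ → AlgebraicClosure K) (m : ℕ) : Prop :=
  ¬InK K (ε 2) ∧ 3 ≤ m ∧ InK K (ε m - (ε m)⁻¹)

/-- `a ∈ K_s = K* ∩ (K(ε₂)*)^{2^s}`: `a = α^{2^s}` for some `α ∈ K(ε₂)*`. -/
def MemKs (K : Type*) [Field K] (ε : ℕ → AlgebraicClosure K) (s : ℕ) (a : K) : Prop :=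
  ∃ α : AlgebraicClosure K, α ∈ IntermediateField.adjoin K {ε 2} ∧ α ≠ 0 ∧
    algebraMap K (AlgebraicClosure K) a = α ^ 2 ^ s

/-- A minimal idempotent of a commutative ring: a nonzero idempotent which is not
the sum of two nonzero orthogonal idempotents. -/
def IsMinIdem {A : Type*} [CommRing A] (e : A) : Prop :=
  e ≠ 0 ∧ e * e = e ∧
    ¬∃ e₁ e₂ : A, e₁ ≠ 0 ∧ e₂ ≠ 0 ∧ e₁ * e₁ = e₁ ∧ e₂ * e₂ = e₂ ∧
      e₁ * e₂ = 0 ∧ e = e₁ + e₂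

/-- If `-1` is a square in `L` and `a` is not, then `X ^ 2 ^ n - a` is irreducible over `L`. -/
theorem irreducible_X_pow_two_pow_sub_C {L : Type*} [Field L] {i a : L} (hi : i ^ 2 = -1)
    (ha : ∀ b : L, b ^ 2 ≠ a) (n : ℕ) :
    Irreducible (Polynomial.X ^ 2 ^ n - Polynomial.C a) := by
  induction n generalizing L with
  | zero => simpa using Polynomial.irreducible_X_sub_C a
  | succ n IH =>
    rw [pow_succ]
    have hirr := X_pow_sub_C_irreducible_of_prime Nat.prime_two ha
    refine X_pow_mul_sub_C_irreducible hirr fun E _ _ x hx ↦ ?_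
    have hx_int : IsIntegral L x := minpoly.ne_zero_iff.mp (hx ▸ hirr.ne_zero)
    refine IH (i := algebraMap L _ i) (by rw [← map_pow, hi, map_neg, map_one]) fun b hb ↦ ?_
    have hnorm : Algebra.norm L b ^ 2 = -a := by
      rw [← map_pow, hb, ← IntermediateField.adjoin.powerBasis_gen hx_int,
        Algebra.PowerBasis.norm_gen_eq_coeff_zero_minpoly]
      simp [IntermediateField.minpoly_gen, hx]
    apply ha (i * Algebra.norm L b)
    rw [mul_pow, hi, hnorm, neg_one_mul, neg_neg]

/-- The unity element is the only minimal idempotent of a field. -/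
theorem isMinIdem_iff_eq_one {F : Type*} [Field F] (e : F) : IsMinIdem e ↔ e = 1 := by
  have idem {x : F} (h0 : x ≠ 0) (h : x * x = x) : x = 1 := by simpa [h0] using h
  refine ⟨fun h ↦ idem h.1 h.2.1, ?_⟩
  rintro rfl
  refine ⟨one_ne_zero, one_mul 1, ?_⟩
  rintro ⟨e₁, e₂, h₁, h₂, -, -, h, -⟩
  exact mul_ne_zero h₁ h₂ h

/-- Theorem 3, case 1): `ε₂ ∉ K` and `H_n(a) = 0`.  Then the unity element is
the unique minimal idempotent of `A = K[X]/(X^{2^n} - a)`. -/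
theorem stmt_15 (K : Type*) [Field K] (h2 : (2 : K) ≠ 0)
    (ε : ℕ → AlgebraicClosure K)
    (hprim : ∀ n : ℕ, IsPrimitiveRoot (ε n) (2 ^ n))
    (hcomp : ∀ n : ℕ, ε (n + 1) ^ 2 = ε n)
    (hε2 : ¬InK K (ε 2))
    (n : ℕ) (hn : 1 ≤ n) (a : K) (ha : a ≠ 0)
    -- `H_n(a) = 0`:
    (hmem : MemKs K ε 0 a)
    (hmax : ∀ t : ℕ, t ≤ n → MemKs K ε t a → t = 0) :
    ∀ e : AdjoinRoot (Polynomial.X ^ 2 ^ n - Polynomial.C a),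
      IsMinIdem e ↔ e = 1 := by
  have hsq : ε 2 ^ 2 = -1 := by
    rw [hcomp 1]
    exact (show IsPrimitiveRoot (ε 1) 2 by simpa using hprim 1).eq_neg_one_of_two_right
  have hε2_mem := IntermediateField.mem_adjoin_simple_self K (ε 2)
  have hnonsq : ∀ b : IntermediateField.adjoin K {ε 2}, b ^ 2 ≠ algebraMap K _ a := by
    intro b hb
    have hb0 : b ≠ 0 := by
      rintro rfl
      exact ha (by simpa using hb.symm)
    refine one_ne_zero (hmax 1 hn ⟨b, b.2, by simpa using hb0, ?_⟩)
    simpa using (congrArg Subtype.val hb).symm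
  have hirr : Irreducible (Polynomial.X ^ 2 ^ n - Polynomial.C a) := by
    apply (Polynomial.monic_X_pow_sub_C a (by positivity)).irreducible_of_irreducible_map
      (algebraMap K (IntermediateField.adjoin K {ε 2}))
    simpa using irreducible_X_pow_two_pow_sub_C (i := ⟨ε 2, hε2_mem⟩) (Subtype.ext hsq) hnonsq n
  have := Fact.mk hirr
  exact isMinIdem_iff_eq_one
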